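/- arXiv:2508.01993 — 3 statements merged into one kernel-verified Lean document; each statement's English description precedes it below -/
import Mathlib

section
/- For all weights x, y > 0, the weighted connective constant of self-avoiding trails on the square lattice satisfies μ^T(x,y) ≤ (1/2)·(x + y + √(x² + 14xy + y²)). -/
open scoped BigOperators

def sqStep : Fin 4 → ℤ × ℤ
  | 0 => (1, 0)
  | 1 => (-1, 0)
  | 2 => (0, 1)
  | 3 => (0, -1)

/-- Position of the walk after `i` steps, starting at the origin. -/
def sqPos {n : ℕ} (ω : Fin n → Fin 4) (i : Fin (n + 1)) : ℤ × ℤ :=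
  ∑ j : Fin n, if (j : ℕ) < (i : ℕ) then sqStep (ω j) else 0

/-- A walk is a self-avoiding trail if its undirected edges are pairwise distinct. -/
def sqIsSAT {n : ℕ} (ω : Fin n → Fin 4) : Prop :=
  Function.Injective (fun i : Fin n => s(sqPos ω i.castSucc, sqPos ω i.succ))

/-- Number of horizontal steps. -/
def sqNh {n : ℕ} (ω : Fin n → Fin 4) : ℕ :=
  (Finset.univ.filter fun j => ω j = 0 ∨ ω j = 1).card

/-- Number of vertical steps. -/
def sqNv {n : ℕ} (ω : Fin n → Fin 4) : ℕ :=
  (Finset.univ.filter fun j => ω j = 2 ∨ ω j = 3).card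

/-- Weight `x^{N_h} y^{N_v}` of a walk. -/
noncomputable def sqWeight (x y : ℝ) {n : ℕ} (ω : Fin n → Fin 4) : ℝ :=
  x ^ sqNh ω * y ^ sqNv ω

/- `satCount n x y` is `c^T_n(x,y)`: the sum of the weights of all `n`-step
self-avoiding trails starting at the origin. -/
open Classical in
noncomputable def satCount (n : ℕ) (x y : ℝ) : ℝ :=
  ∑ ω ∈ Finset.univ.filter (fun ω : Fin n → Fin 4 => sqIsSAT ω), sqWeight x y ω

/-- The weighted connective constant `μ^T(x,y) = inf_{n ≥ 1} c^T_n(x,y)^{1/n}`. -/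
noncomputable def satMu (x y : ℝ) : ℝ :=
  ⨅ n : ℕ, satCount (n + 1) x y ^ (1 / (n + 1 : ℝ))

/-- The direction opposite to a given one. -/
def sqOpp : Fin 4 → Fin 4
  | 0 => 1
  | 1 => 0
  | 2 => 3
  | 3 => 2

/-- A walk is non-backtracking if no step is followed by its reverse. -/
def sqNonBacktracking {n : ℕ} (ω : Fin n → Fin 4) : Prop :=
  ∀ i j : Fin n, (j : ℕ) = i + 1 → ω j ≠ sqOpp (ω i)

/-- Weight of a single step. -/
def sqStepWeight (x y : ℝ) : Fin 4 → ℝ := ![x, x, y, y]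

theorem sqStep_sqOpp (d : Fin 4) : sqStep d + sqStep (sqOpp d) = 0 := by
  fin_cases d <;> rfl

theorem sqPos_succ {n : ℕ} (ω : Fin n → Fin 4) (i : Fin n) :
    sqPos ω i.succ = sqPos ω i.castSucc + sqStep (ω i) := by
  have h : sqStep (ω i) = ∑ j : Fin n, if j = i then sqStep (ω j) else 0 := by simp
  rw [sqPos, sqPos, h, ← Finset.sum_add_distrib]
  refine Finset.sum_congr rfl fun j _ => ?_
  rcases lt_trichotomy j i with hji | hji | hji
  · have : (j : ℕ) < i := hji
    simp [hji.ne, this, Nat.lt_succ_of_lt this]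
  · simp [hji]
  · have : (i : ℕ) < j := hji
    have h₁ : ¬ (j : ℕ) < i + 1 := by omega
    have h₂ : ¬ (j : ℕ) < i := by omega
    simp only [Fin.val_succ, Fin.val_castSucc, h₁, h₂, hji.ne', if_false, add_zero]

theorem sqIsSAT.nonBacktracking {n : ℕ} {ω : Fin n → Fin 4} (h : sqIsSAT ω) :
    sqNonBacktracking ω := by
  intro i j hij hω
  have hcs : j.castSucc = i.succ := Fin.ext (by simpa using hij)
  have hpos : sqPos ω j.succ = sqPos ω i.castSucc := by
    rw [sqPos_succ, hcs, sqPos_succ, hω, add_assoc, sqStep_sqOpp, add_zero]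
  have : i = j := h (by simp only [hcs, hpos, Sym2.eq_swap])
  simp [this] at hij

theorem sqWeight_eq_prod (x y : ℝ) {n : ℕ} (ω : Fin n → Fin 4) :
    sqWeight x y ω = ∏ j, sqStepWeight x y (ω j) := by
  rw [sqWeight, sqNh, sqNv, ← Finset.prod_const, ← Finset.prod_const, Finset.prod_filter,
    Finset.prod_filter, ← Finset.prod_mul_distrib]
  refine Finset.prod_congr rfl fun j _ => ?_
  generalize ω j = d
  fin_cases d <;> simp [sqStepWeight]

theorem sqNonBacktracking.tail {n : ℕ} {d : Fin 4} {ω : Fin n → Fin 4}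
    (h : sqNonBacktracking (Fin.cons d ω : Fin (n + 1) → Fin 4)) : sqNonBacktracking ω :=
  fun i j hij => by simpa using h i.succ j.succ (by simpa using hij)

theorem sqNonBacktracking.ne_opp {n : ℕ} {d e : Fin 4} {ω : Fin n → Fin 4}
    (h : sqNonBacktracking (Fin.cons d (Fin.cons e ω : Fin (n + 1) → Fin 4) :
      Fin (n + 2) → Fin 4)) : e ≠ sqOpp d := by
  simpa using h 0 (Fin.succ 0) (by simp)

theorem sum_fin_succ_pi {α M : Type*} [Fintype α] [AddCommMonoid M] {n : ℕ}
    (F : (Fin (n + 1) → α) → M) :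
    ∑ ω, F ω = ∑ e, ∑ ω : Fin n → α, F (Fin.cons e ω) := by
  rw [← Fintype.sum_prod_type']
  exact (Fintype.sum_equiv (Fin.consEquiv fun _ => α) _ _ fun _ => rfl).symm

open Classical in
/-- If `f` is a positive potential which is contracted by the transfer matrix of
non-backtracking walks at rate `r`, then the weight of the `n`-step continuations of a
step `d` is at most `f d * r ^ n`. -/
theorem sum_nonBacktracking_cons_le {w f : Fin 4 → ℝ} {r : ℝ} (hw : ∀ d, 0 ≤ w d)
    (hf : ∀ d, 1 ≤ f d) (hr : 0 ≤ r)
    (hstep : ∀ d, ∑ e, (if e ≠ sqOpp d then w e * f e else 0) ≤ r * f d) (n : ℕ) (d : Fin 4) :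
    ∑ ω : Fin n → Fin 4,
      (if sqNonBacktracking (Fin.cons d ω : Fin (n + 1) → Fin 4) then ∏ j, w (ω j) else 0)
      ≤ f d * r ^ n := by
  induction n generalizing d with
  | zero =>
    refine le_trans ?_ ((hf d).trans_eq (by simp))
    simp only [Finset.univ_unique, Finset.sum_singleton, Finset.univ_eq_empty,
      Finset.prod_empty]
    split_ifs <;> norm_num
  | succ n ih =>
    rw [sum_fin_succ_pi]
    calc _ ≤ ∑ e, (if e ≠ sqOpp d then w e * f e else 0) * r ^ n := by
          refine Finset.sum_le_sum fun e _ => ?_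
          by_cases he : e = sqOpp d
          · rw [if_neg (not_not.mpr he), zero_mul]
            refine (Finset.sum_eq_zero fun ω _ => if_neg fun h => h.ne_opp he).le
          · rw [if_pos he, mul_assoc]
            refine le_trans ?_ (mul_le_mul_of_nonneg_left (ih e) (hw e))
            rw [Finset.mul_sum]
            refine Finset.sum_le_sum fun ω _ => ?_
            have hp : 0 ≤ ∏ j, w (ω j) := Finset.prod_nonneg fun j _ => hw _
            rw [Fin.prod_univ_succ]
            simp only [Fin.cons_zero, Fin.cons_succ]
            by_cases h : sqNonBacktracking
                (Fin.cons d (Fin.cons e ω : Fin (n + 1) → Fin 4) : Fin (n + 2) → Fin 4)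
            · rw [if_pos h, if_pos h.tail]
            · rw [if_neg h]
              exact mul_nonneg (hw e) (by split_ifs <;> simp [hp])
      _ ≤ r * f d * r ^ n := by
          rw [← Finset.sum_mul]
          exact mul_le_mul_of_nonneg_right (hstep d) (pow_nonneg hr n)
      _ = f d * r ^ (n + 1) := by ring

theorem sqStepWeight_pos {x y : ℝ} (hx : 0 < x) (hy : 0 < y) (d : Fin 4) :
    0 < sqStepWeight x y d := by
  fin_cases d <;> simpa [sqStepWeight]

theorem satCount_nonneg {x y : ℝ} (hx : 0 < x) (hy : 0 < y) (n : ℕ) : 0 ≤ satCount n x y :=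
  Finset.sum_nonneg fun ω _ => by unfold sqWeight; positivity

open Classical in
theorem satCount_succ_le {x y r : ℝ} {f : Fin 4 → ℝ} (hx : 0 < x) (hy : 0 < y)
    (hf : ∀ d, 1 ≤ f d) (hr : 0 ≤ r)
    (hstep : ∀ d, ∑ e, (if e ≠ sqOpp d then sqStepWeight x y e * f e else 0) ≤ r * f d)
    (n : ℕ) :
    satCount (n + 1) x y ≤ (∑ d, sqStepWeight x y d * f d) * r ^ n := by
  have hw d := (sqStepWeight_pos hx hy d).le
  rw [satCount, Finset.sum_filter, sum_fin_succ_pi, Finset.sum_mul]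
  refine Finset.sum_le_sum fun d _ => ?_
  rw [mul_assoc]
  refine le_trans ?_ (mul_le_mul_of_nonneg_left
    (sum_nonBacktracking_cons_le hw hf hr hstep n d) (hw d))
  rw [Finset.mul_sum]
  refine Finset.sum_le_sum fun ω _ => ?_
  by_cases h : sqIsSAT (Fin.cons d ω : Fin (n + 1) → Fin 4)
  · rw [if_pos h, if_pos h.nonBacktracking, sqWeight_eq_prod, Fin.prod_univ_succ]
    simp
  · rw [if_neg h]
    refine mul_nonneg (hw d) ?_
    split_ifs
    · exact Finset.prod_nonneg fun j _ => hw _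
    · exact le_rfl

theorem satMu_le_of_satCount_le {x y r K : ℝ} (hx : 0 < x) (hy : 0 < y) (hr : 0 < r)
    (hK : 0 < K) (h : ∀ n, satCount (n + 1) x y ≤ K * r ^ n) : satMu x y ≤ r := by
  have hle (n : ℕ) : satMu x y ≤ (K / r) ^ (1 / (n + 1 : ℝ)) * r := by
    have hb : BddBelow (Set.range fun n : ℕ => satCount (n + 1) x y ^ (1 / (n + 1 : ℝ))) :=
      ⟨0, by rintro _ ⟨m, rfl⟩; exact Real.rpow_nonneg (satCount_nonneg hx hy _) _⟩
    refine (ciInf_le hb n).trans ?_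
    refine (Real.rpow_le_rpow (satCount_nonneg hx hy _) (h n) (by positivity)).trans_eq ?_
    have hn : K * r ^ n = K / r * r ^ (n + 1) := by rw [pow_succ]; field_simp
    rw [hn, Real.mul_rpow (by positivity) (by positivity)]
    congr 1
    have := Real.pow_rpow_inv_natCast hr.le (Nat.succ_ne_zero n)
    simpa using this
  have hlim : Filter.Tendsto (fun n : ℕ => (K / r) ^ (1 / (n + 1 : ℝ)) * r) Filter.atTop
      (nhds r) := by
    have h₀ := tendsto_one_div_add_atTop_nhds_zero_nat (𝕜 := ℝ)
    have := ((Real.continuous_const_rpow (a := K / r) (by positivity)).tendsto 0 |>.comp h₀).mul_const r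
    simpa [Function.comp_def] using this
  exact ge_of_tendsto' hlim hle

theorem satMu_le_bound_m1_n2 (x y : ℝ) (hx : 0 < x) (hy : 0 < y) :
    satMu x y ≤ (x + y + Real.sqrt (x ^ 2 + 14 * x * y + y ^ 2)) / 2 := by
  have hxy := mul_pos hx hy
  have hsq := Real.sq_sqrt (show 0 ≤ x ^ 2 + 14 * x * y + y ^ 2 by positivity)
  have hlt : x - y < Real.sqrt (x ^ 2 + 14 * x * y + y ^ 2) :=
    Real.lt_sqrt_of_sq_lt (by nlinarith)
  generalize Real.sqrt (x ^ 2 + 14 * x * y + y ^ 2) = s at *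
  set r := (x + y + s) / 2 with hr
  have hrx : 0 < r - x := by linarith
  have hr0 : 0 < r := by linarith
  have hchar : (r - x) * (r - y) = 4 * x * y := by rw [hr]; linarith
  set C := 1 / (2 * y) + 1 / (r - x) with hC
  have ha : 1 ≤ 2 * y * C := by
    have : 2 * y * C = 1 + 2 * y / (r - x) := by rw [hC]; field_simp
    rw [this]; linarith [show 0 < 2 * y / (r - x) by positivity]
  have hb : 1 ≤ (r - x) * C := by
    have : (r - x) * C = (r - x) / (2 * y) + 1 := by rw [hC]; field_simp
    rw [this]; linarith [show 0 < (r - x) / (2 * y) by positivity]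
  set f : Fin 4 → ℝ := ![2 * y * C, 2 * y * C, (r - x) * C, (r - x) * C] with hfdef
  have hf : ∀ d, 1 ≤ f d := by
    intro d
    fin_cases d <;> simpa [hfdef]
  refine satMu_le_of_satCount_le hx hy hr0 (K := ∑ d, sqStepWeight x y d * f d) ?_
    (satCount_succ_le hx hy hf hr0.le ?_)
  · exact Finset.sum_pos
      (fun d _ => mul_pos (sqStepWeight_pos hx hy d) (zero_lt_one.trans_le (hf d)))
      Finset.univ_nonempty
  · intro d
    refine le_of_eq ?_
    fin_cases d <;> simp [Fin.sum_univ_four, sqOpp, sqStepWeight, hfdef] <;>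
      first
        | ring1
        | linear_combination (-C) * hchar
end

section
/- For all weights x, z > 0, the weighted connective constant of self-avoiding trails on the simple cubic lattice, with steps in the ±e₁ and ±e₂ directions weighted x and steps in the ±e₃ direction weighted z, satisfies μ₃^T(x,z) ≤ (1/2)·(3x + z + √(9x² + 26xz + z²)). -/
open scoped BigOperators

def cubeStep : Fin 6 → ℤ × ℤ × ℤ
  | 0 => (1, 0, 0)
  | 1 => (-1, 0, 0)
  | 2 => (0, 1, 0)
  | 3 => (0, -1, 0)
  | 4 => (0, 0, 1)
  | 5 => (0, 0, -1)

/-- Position of the walk after `i` steps, starting at the origin. -/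
def cubePos {n : ℕ} (ω : Fin n → Fin 6) (i : Fin (n + 1)) : ℤ × ℤ × ℤ :=
  ∑ j : Fin n, if (j : ℕ) < (i : ℕ) then cubeStep (ω j) else 0

/-- Number of steps in the `±e₁` or `±e₂` directions. -/
def cubeNxy {n : ℕ} (ω : Fin n → Fin 6) : ℕ :=
  (Finset.univ.filter fun j => ω j = 0 ∨ ω j = 1 ∨ ω j = 2 ∨ ω j = 3).card

/-- Number of steps in the `±e₃` directions. -/
def cubeNz {n : ℕ} (ω : Fin n → Fin 6) : ℕ :=
  (Finset.univ.filter fun j => ω j = 4 ∨ ω j = 5).card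

/-- Weight `x^{N₁+N₂} z^{N₃}` of a walk. -/
noncomputable def cubeWeight (x z : ℝ) {n : ℕ} (ω : Fin n → Fin 6) : ℝ :=
  x ^ cubeNxy ω * z ^ cubeNz ω

/-- A walk is a self-avoiding trail if its undirected edges are pairwise distinct. -/
def cubeIsSAT {n : ℕ} (ω : Fin n → Fin 6) : Prop :=
  Function.Injective (fun i : Fin n => s(cubePos ω i.castSucc, cubePos ω i.succ))

/- `cubeSatCount n x z` is `c^T_n(x,z)`: the sum of the weights of all `n`-step
self-avoiding trails starting at the origin. -/
open Classical in
noncomputable def cubeSatCount (n : ℕ) (x z : ℝ) : ℝ :=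
  ∑ ω ∈ Finset.univ.filter (fun ω : Fin n → Fin 6 => cubeIsSAT ω), cubeWeight x z ω

/-- The weighted connective constant `μ₃^T(x,z) = inf_{n ≥ 1} c^T_n(x,z)^{1/n}`. -/
noncomputable def cubeSatMu (x z : ℝ) : ℝ :=
  ⨅ n : ℕ, cubeSatCount (n + 1) x z ^ (1 / (n + 1 : ℝ))

/-- The step opposite to a given step. -/
def cubeRev : Fin 6 → Fin 6 := ![1, 0, 3, 2, 5, 4]

/-- A walk is non-reversing if no step is immediately undone by the next one. -/
def CubeNonReversing {n : ℕ} (ω : Fin (n + 1) → Fin 6) : Prop :=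
  ∀ i : Fin n, ω i.succ ≠ cubeRev (ω i.castSucc)

/-- Weight of a single step. -/
def cubeStepWeight (x z : ℝ) (s : Fin 6) : ℝ := ![x, x, x, x, z, z] s

lemma cubeStep_cubeRev (s : Fin 6) : cubeStep s + cubeStep (cubeRev s) = 0 := by
  fin_cases s <;> simp [cubeStep, cubeRev]

lemma cubePos_succ {n : ℕ} (ω : Fin n → Fin 6) (i : Fin n) :
    cubePos ω i.succ = cubePos ω i.castSucc + cubeStep (ω i) := by
  unfold cubePos
  rw [show cubeStep (ω i) = ∑ j, if j = i then cubeStep (ω j) else 0 by simp,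
    ← Finset.sum_add_distrib]
  refine Finset.sum_congr rfl fun j _ => ?_
  rcases lt_trichotomy j i with h | h | h
  · have h' : (j : ℕ) < i := h
    simp [h.ne, h', Nat.lt_succ_of_lt h']
  · simp [h]
  · have h' : (i : ℕ) < j := h
    simp [h.ne', h.not_gt, h'.not_ge]

lemma cubeIsSAT.nonReversing {n : ℕ} {ω : Fin (n + 1) → Fin 6} (h : cubeIsSAT ω) :
    CubeNonReversing ω := by
  intro i hi
  have h1 := cubePos_succ ω i.succ
  have h2 := cubePos_succ ω i.castSucc
  have h3 : i.castSucc = i.succ := by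
    apply h
    simp only
    rw [h1, h2, hi, ← Fin.succ_castSucc, h2, add_assoc, cubeStep_cubeRev, add_zero, Sym2.eq_swap]
  exact (Fin.castSucc_lt_succ (i := i)).ne h3

lemma cubeWeight_eq_prod (x z : ℝ) {n : ℕ} (ω : Fin n → Fin 6) :
    cubeWeight x z ω = ∏ j, cubeStepWeight x z (ω j) := by
  have h : ∀ s : Fin 6, cubeStepWeight x z s =
      (if s = 0 ∨ s = 1 ∨ s = 2 ∨ s = 3 then x else 1) * (if s = 4 ∨ s = 5 then z else 1) := by
    intro s
    fin_cases s <;> simp [cubeStepWeight]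
  simp only [h, Finset.prod_mul_distrib]
  simp only [Finset.prod_ite, Finset.prod_const, one_pow, mul_one, cubeWeight, cubeNxy, cubeNz]

lemma cubeStepWeight_pos {x z : ℝ} (hx : 0 < x) (hz : 0 < z) (s : Fin 6) :
    0 < cubeStepWeight x z s := by
  fin_cases s <;> simpa [cubeStepWeight]

lemma cubeNonReversing_cons {n : ℕ} (s : Fin 6) (ω : Fin (n + 1) → Fin 6) :
    CubeNonReversing (Fin.cons s ω : Fin (n + 1 + 1) → Fin 6) ↔
      ω 0 ≠ cubeRev s ∧ CubeNonReversing ω := by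
  simp [CubeNonReversing, Fin.forall_fin_succ (n := n)]

lemma sum_pi_fin_succ {α : Type*} [Fintype α] {n : ℕ} (f : (Fin (n + 1) → α) → ℝ) :
    ∑ ω, f ω = ∑ s : α, ∑ ω : Fin n → α, f (Fin.cons s ω) := by
  rw [← Fintype.sum_prod_type']
  exact (Fintype.sum_equiv (Fin.consEquiv fun _ => α) _ _ fun _ => rfl).symm

open Classical in
/-- Total weight of the `n`-step continuations of the step `s` without reversals. -/
noncomputable def cubeContinuations (x z : ℝ) (n : ℕ) (s : Fin 6) : ℝ :=
  ∑ ω : Fin n → Fin 6, if CubeNonReversing (Fin.cons s ω : Fin (n + 1) → Fin 6) then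
    ∏ j, cubeStepWeight x z (ω j) else 0

lemma cubeContinuations_succ (x z : ℝ) (n : ℕ) (s : Fin 6) :
    cubeContinuations x z (n + 1) s = ∑ t, if t ≠ cubeRev s then
      cubeStepWeight x z t * cubeContinuations x z n t else 0 := by
  unfold cubeContinuations
  rw [sum_pi_fin_succ]
  refine Finset.sum_congr rfl fun t _ => ?_
  have hcons : ∀ ω : Fin n → Fin 6,
      CubeNonReversing (Fin.cons s (Fin.cons t ω : Fin (n + 1) → Fin 6) : Fin (n + 1 + 1) → Fin 6) ↔
        t ≠ cubeRev s ∧ CubeNonReversing (Fin.cons t ω : Fin (n + 1) → Fin 6) :=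
    fun ω => cubeNonReversing_cons s _
  simp only [Fin.prod_univ_succ, Fin.cons_zero, Fin.cons_succ]
  by_cases h : t = cubeRev s
  · rw [if_neg (not_not.mpr h)]
    exact Finset.sum_eq_zero fun ω _ => if_neg fun hω => ((hcons ω).mp hω).1 h
  · rw [if_pos h, Finset.mul_sum]
    refine Finset.sum_congr rfl fun ω _ => ?_
    rw [mul_ite, mul_zero]
    classical exact if_congr ((hcons ω).trans (and_iff_right h)) rfl rfl

lemma cubeContinuations_le {x z l : ℝ} {v : Fin 6 → ℝ} (hx : 0 < x) (hz : 0 < z)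
    (hv : ∀ s, 1 ≤ v s)
    (h : ∀ s, ∑ t, (if t ≠ cubeRev s then cubeStepWeight x z t * v t else 0) = l * v s)
    (n : ℕ) (s : Fin 6) : cubeContinuations x z n s ≤ v s * l ^ n := by
  have hl : 0 ≤ l := by
    have h0 : 0 ≤ l * v 0 := by
      rw [← h 0]
      refine Finset.sum_nonneg fun t _ => ?_
      have := cubeStepWeight_pos hx hz t
      have := hv t
      split_ifs <;> positivity
    exact nonneg_of_mul_nonneg_left h0 (by linarith [hv 0])
  induction n generalizing s with
  | zero => simpa [cubeContinuations, CubeNonReversing] using hv s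
  | succ n ih =>
    rw [cubeContinuations_succ, pow_succ', ← mul_assoc, mul_comm (v s), ← h s, Finset.sum_mul]
    refine Finset.sum_le_sum fun t _ => ?_
    split_ifs
    · rw [mul_assoc]
      exact mul_le_mul_of_nonneg_left (ih t) (cubeStepWeight_pos hx hz t).le
    · simp

lemma cubeSatCount_nonneg {x z : ℝ} (hx : 0 < x) (hz : 0 < z) (n : ℕ) :
    0 ≤ cubeSatCount n x z := by
  unfold cubeSatCount cubeWeight
  positivity

lemma cubeSatCount_succ_le {x z : ℝ} (hx : 0 < x) (hz : 0 < z) (n : ℕ) :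
    cubeSatCount (n + 1) x z ≤ ∑ s, cubeStepWeight x z s * cubeContinuations x z n s := by
  classical
  unfold cubeSatCount cubeContinuations
  rw [Finset.sum_filter, sum_pi_fin_succ]
  refine Finset.sum_le_sum fun s _ => ?_
  rw [Finset.mul_sum]
  refine Finset.sum_le_sum fun ω _ => ?_
  rw [cubeWeight_eq_prod, Fin.prod_univ_succ]
  simp only [Fin.cons_zero, Fin.cons_succ]
  have hp : 0 ≤ cubeStepWeight x z s * ∏ j, cubeStepWeight x z (ω j) :=
    mul_nonneg (cubeStepWeight_pos hx hz s).le
      (Finset.prod_nonneg fun j _ => (cubeStepWeight_pos hx hz _).le)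
  by_cases h : cubeIsSAT (Fin.cons s ω : Fin (n + 1) → Fin 6)
  · simp [h, h.nonReversing]
  · rw [if_neg h]
    split_ifs <;> simp [hp]

/-- A pure exponential bound on the trail counts bounds the connective constant. -/
lemma cubeSatMu_le_of_forall_le {x z C l : ℝ} (hx : 0 < x) (hz : 0 < z) (hC : 0 < C) (hl : 0 ≤ l)
    (h : ∀ n, cubeSatCount (n + 1) x z ≤ C * l ^ (n + 1)) : cubeSatMu x z ≤ l := by
  have hle : ∀ n : ℕ, cubeSatMu x z ≤ C ^ (1 / (n + 1 : ℝ)) * l := by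
    intro n
    have hbdd : BddBelow (Set.range fun n : ℕ => cubeSatCount (n + 1) x z ^ (1 / (n + 1 : ℝ))) :=
      ⟨0, by
        rintro _ ⟨m, rfl⟩
        exact Real.rpow_nonneg (cubeSatCount_nonneg hx hz _) _⟩
    refine (ciInf_le hbdd n).trans ?_
    refine (Real.rpow_le_rpow (cubeSatCount_nonneg hx hz _) (h n) (by positivity)).trans_eq ?_
    rw [Real.mul_rpow hC.le (by positivity)]
    congr 1
    have := Real.pow_rpow_inv_natCast hl n.succ_ne_zero
    simpa [one_div] using this
  have hlim : Filter.Tendsto (fun n : ℕ => C ^ (1 / (n + 1 : ℝ)) * l) Filter.atTop (nhds l) := by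
    have := ((Real.continuousAt_const_rpow hC.ne').tendsto.comp
      (tendsto_one_div_add_atTop_nhds_zero_nat (𝕜 := ℝ))).mul_const l
    simpa using this
  exact ge_of_tendsto' hlim hle

theorem cubeSatMu_le_bound_m1_n2 (x z : ℝ) (hx : 0 < x) (hz : 0 < z) :
    cubeSatMu x z ≤ (3 * x + z + Real.sqrt (9 * x ^ 2 + 26 * x * z + z ^ 2)) / 2 := by
  set l := (3 * x + z + Real.sqrt (9 * x ^ 2 + 26 * x * z + z ^ 2)) / 2 with hldef
  have hxz := mul_pos hx hz
  have hsq := Real.sq_sqrt (show 0 ≤ 9 * x ^ 2 + 26 * x * z + z ^ 2 by positivity)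
  have hl3 : 3 * x < l := by
    have : 3 * x - z < Real.sqrt (9 * x ^ 2 + 26 * x * z + z ^ 2) :=
      Real.lt_sqrt_of_sq_lt (by nlinarith)
    linarith
  have hquad : l ^ 2 = (3 * x + z) * l + 5 * (x * z) := by
    rw [hldef]
    linear_combination hsq / 4
  have hl : 0 < l := by linarith
  obtain ⟨c, hc1, hc2⟩ : ∃ c : ℝ, 1 ≤ c * (2 * z) ∧ 1 ≤ c * (l - 3 * x) := by
    have h3 : 0 < l - 3 * x := by linarith
    refine ⟨1 / (2 * z) + 1 / (l - 3 * x), ?_, ?_⟩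
    · rw [add_mul, one_div_mul_cancel (by positivity)]
      have : 0 ≤ 1 / (l - 3 * x) * (2 * z) := by positivity
      linarith
    · rw [add_mul, one_div_mul_cancel h3.ne']
      have : 0 ≤ 1 / (2 * z) * (l - 3 * x) := by positivity
      linarith
  let v : Fin 6 → ℝ := cubeStepWeight (c * (2 * z)) (c * (l - 3 * x))
  have hv : ∀ s, 1 ≤ v s := by
    intro s
    fin_cases s <;> simpa [v, cubeStepWeight]
  have heig : ∀ s, ∑ t, (if t ≠ cubeRev s then cubeStepWeight x z t * v t else 0) = l * v s := by
    intro s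
    fin_cases s <;> simp [v, cubeStepWeight, cubeRev, Fin.sum_univ_succ] <;>
      first
        | ring1
        | linear_combination (-c) * hquad
  have hpos : ∀ s, 0 < cubeStepWeight x z s * v s := fun s =>
    mul_pos (cubeStepWeight_pos hx hz s) (by linarith [hv s])
  refine cubeSatMu_le_of_forall_le hx hz (C := (∑ s, cubeStepWeight x z s * v s) / l)
    (div_pos (Finset.sum_pos (fun s _ => hpos s) Finset.univ_nonempty) hl) hl.le fun n => ?_
  refine (cubeSatCount_succ_le hx hz n).trans ?_
  rw [pow_succ', ← mul_assoc, div_mul_cancel₀ _ hl.ne', Finset.sum_mul]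
  refine Finset.sum_le_sum fun s _ => ?_
  rw [mul_assoc]
  exact mul_le_mul_of_nonneg_left (cubeContinuations_le hx hz hv heig n s)
    (cubeStepWeight_pos hx hz s).le
end

section
/- For all weights x, z > 0, the weighted connective constant of self-avoiding walks on the triangular lattice, with steps in the ±(1,0) and ±(0,1) directions weighted x and steps in the ±(1,1) directions weighted z, satisfies μ_T(x,z) ≤ 2^{−1/2}·[9x² + 15xz + z² + √(81x⁴ + 182x³z + 143x²z² + 34xz³ + z⁴)]^{1/2}. -/
open scoped BigOperators

def triStep : Fin 6 → ℤ × ℤ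
  | 0 => (1, 0)
  | 1 => (-1, 0)
  | 2 => (0, 1)
  | 3 => (0, -1)
  | 4 => (1, 1)
  | 5 => (-1, -1)

/-- Position of the walk after `i` steps, starting at the origin. -/
def triPos {n : ℕ} (ω : Fin n → Fin 6) (i : Fin (n + 1)) : ℤ × ℤ :=
  ∑ j : Fin n, if (j : ℕ) < (i : ℕ) then triStep (ω j) else 0

/-- Number of steps in the `±(1,0)` or `±(0,1)` directions. -/
def triNa {n : ℕ} (ω : Fin n → Fin 6) : ℕ :=
  (Finset.univ.filter fun j => ω j = 0 ∨ ω j = 1 ∨ ω j = 2 ∨ ω j = 3).card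

/-- Number of steps in the `±(1,1)` directions. -/
def triNd {n : ℕ} (ω : Fin n → Fin 6) : ℕ :=
  (Finset.univ.filter fun j => ω j = 4 ∨ ω j = 5).card

/-- Weight `x^{N_a} z^{N_d}` of a walk. -/
noncomputable def triWeight (x z : ℝ) {n : ℕ} (ω : Fin n → Fin 6) : ℝ :=
  x ^ triNa ω * z ^ triNd ω

/-- A walk is self-avoiding if its vertices are pairwise distinct. -/
def triIsSAW {n : ℕ} (ω : Fin n → Fin 6) : Prop :=
  Function.Injective (triPos ω)

/- `triSawCount n x z` is `c_n(x,z)`: the sum of the weights of all `n`-step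
self-avoiding walks starting at the origin. -/
open Classical in
noncomputable def triSawCount (n : ℕ) (x z : ℝ) : ℝ :=
  ∑ ω ∈ Finset.univ.filter (fun ω : Fin n → Fin 6 => triIsSAW ω), triWeight x z ω

/-- The weighted connective constant `μ_T(x,z) = inf_{n ≥ 1} c_n(x,z)^{1/n}`. -/
noncomputable def triSawMu (x z : ℝ) : ℝ :=
  ⨅ n : ℕ, triSawCount (n + 1) x z ^ (1 / (n + 1 : ℝ))

/-- Weight of a single step. -/
noncomputable def triStepWeight (x z : ℝ) (s : Fin 6) : ℝ :=
  if s = 4 ∨ s = 5 then z else x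

/-- Three consecutive steps that visit four distinct vertices. -/
def triThreeStepSAW (a b c : Fin 6) : Prop :=
  triStep a + triStep b ≠ 0 ∧ triStep b + triStep c ≠ 0 ∧ triStep a + triStep b + triStep c ≠ 0

instance (a b c : Fin 6) : Decidable (triThreeStepSAW a b c) := by
  unfold triThreeStepSAW; infer_instance

theorem triWeight_eq_prod (x z : ℝ) {n : ℕ} (ω : Fin n → Fin 6) :
    triWeight x z ω = ∏ i, triStepWeight x z (ω i) := by
  unfold triWeight triNa triNd
  rw [← Finset.prod_const, ← Finset.prod_const, Finset.prod_filter, Finset.prod_filter,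
    ← Finset.prod_mul_distrib]
  refine Finset.prod_congr rfl fun i _ => ?_
  generalize ω i = s
  fin_cases s <;> simp [triStepWeight]

theorem triWeight_cons (x z : ℝ) {n : ℕ} (s : Fin 6) (ω : Fin n → Fin 6) :
    triWeight x z (Fin.cons s ω : Fin (n + 1) → Fin 6) = triStepWeight x z s * triWeight x z ω := by
  simp [triWeight_eq_prod, Fin.prod_univ_succ]

theorem triWeight_pos {x z : ℝ} (hx : 0 < x) (hz : 0 < z) {n : ℕ} (ω : Fin n → Fin 6) :
    0 < triWeight x z ω := by
  unfold triWeight; positivity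

theorem triPos_cons_succ {n : ℕ} (s : Fin 6) (ω : Fin n → Fin 6) (i : Fin (n + 1)) :
    triPos (Fin.cons s ω : Fin (n + 1) → Fin 6) i.succ = triStep s + triPos ω i := by
  simp only [triPos, Fin.sum_univ_succ, Fin.cons_zero, Fin.cons_succ, Fin.val_succ, Fin.val_zero,
    Nat.add_lt_add_iff_right, Nat.zero_lt_succ, if_true]

theorem triPos_zero {n : ℕ} (ω : Fin n → Fin 6) : triPos ω 0 = 0 := by
  simp [triPos]

theorem triIsSAW.of_cons {n : ℕ} {s : Fin 6} {ω : Fin n → Fin 6}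
    (h : triIsSAW (Fin.cons s ω : Fin (n + 1) → Fin 6)) : triIsSAW ω := by
  intro i j hij
  apply Fin.succ_injective
  apply h
  rw [triPos_cons_succ, triPos_cons_succ, hij]

theorem triIsSAW.threeStep {n : ℕ} {a b c : Fin 6} {ω : Fin n → Fin 6}
    (h : triIsSAW (Fin.cons a (Fin.cons b (Fin.cons c ω : Fin (n + 1) → Fin 6) :
      Fin (n + 2) → Fin 6) : Fin (n + 3) → Fin 6)) : triThreeStepSAW a b c := by
  have key : ∀ {m : ℕ} {ω : Fin m → Fin 6} {i : Fin m}, triIsSAW ω →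
      triPos ω i.succ ≠ 0 := by
    intro m ω i hω h0
    rw [← triPos_zero ω] at h0
    exact Fin.succ_ne_zero i (hω h0)
  refine ⟨?_, ?_, ?_⟩
  · have := key (i := (0 : Fin (n + 2)).succ) h
    rwa [triPos_cons_succ, triPos_cons_succ, triPos_zero, add_zero] at this
  · have := key (i := (0 : Fin (n + 1)).succ) h.of_cons
    rwa [triPos_cons_succ, triPos_cons_succ, triPos_zero, add_zero] at this
  · have := key (i := (0 : Fin (n + 1)).succ.succ) h
    rwa [triPos_cons_succ, triPos_cons_succ, triPos_cons_succ, triPos_zero, add_zero,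
      ← add_assoc] at this

/-- Sum of the weights of the self-avoiding walks with `n + 1` steps, each multiplied by the
value of `v` at its first step. -/
noncomputable def triFirstStepSum (n : ℕ) (x z : ℝ) (v : Fin 6 → ℝ) : ℝ :=
  open Classical in
  ∑ ω : Fin (n + 1) → Fin 6, if triIsSAW ω then triWeight x z ω * v (ω 0) else 0

theorem sum_fin_succ_pi_s13 {n : ℕ} (f : (Fin (n + 1) → Fin 6) → ℝ) :
    ∑ ω, f ω = ∑ s : Fin 6, ∑ ω : Fin n → Fin 6, f (Fin.cons s ω) := by
  rw [← Fintype.sum_prod_type', ← (Fin.consEquiv fun _ : Fin (n + 1) => Fin 6).sum_comp]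
  rfl

/-- Prepending two steps multiplies the first-step sum by at most `l` when `v` is an
`l`-eigenvector of the matrix of three-step walks. -/
theorem triFirstStepSum_add_two_le {x z l : ℝ} (hx : 0 < x) (hz : 0 < z) {v : Fin 6 → ℝ}
    (hv : ∀ s, 0 ≤ v s)
    (hl : ∀ c, ∑ a, ∑ b, (if triThreeStepSAW a b c then
      triStepWeight x z a * triStepWeight x z b * v a else 0) = l * v c) (n : ℕ) :
    triFirstStepSum (n + 2) x z v ≤ l * triFirstStepSum n x z v := by
  classical
  have hw : ∀ s, 0 < triStepWeight x z s := fun s => by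
    unfold triStepWeight; split_ifs <;> assumption
  unfold triFirstStepSum
  rw [sum_fin_succ_pi_s13]
  simp_rw [sum_fin_succ_pi_s13 (n := n + 1)]
  calc _ ≤ ∑ a, ∑ b, ∑ ω : Fin (n + 1) → Fin 6, (if triIsSAW ω then
          triWeight x z ω * (if triThreeStepSAW a b (ω 0) then
            triStepWeight x z a * triStepWeight x z b * v a else 0) else 0) := by
        refine Finset.sum_le_sum fun a _ => Finset.sum_le_sum fun b _ =>
          Finset.sum_le_sum fun ω _ => ?_
        by_cases h : triIsSAW (Fin.cons a (Fin.cons b ω : Fin (n + 2) → Fin 6) :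
            Fin (n + 3) → Fin 6)
        · have h3 : triThreeStepSAW a b (ω 0) := by
            rw [← Fin.cons_self_tail ω] at h
            exact h.threeStep
          rw [if_pos h, if_pos h.of_cons.of_cons, if_pos h3, triWeight_cons, triWeight_cons,
            Fin.cons_zero]
          exact le_of_eq (by ring)
        · rw [if_neg h]
          have := triWeight_pos hx hz ω
          have := hw a
          have := hw b
          have := hv a
          split_ifs <;> positivity
    _ = ∑ ω : Fin (n + 1) → Fin 6, (if triIsSAW ω then triWeight x z ω * (l * v (ω 0)) else 0) := by
        simp_rw [← hl]
        rw [Finset.sum_congr rfl fun a _ => Finset.sum_comm, Finset.sum_comm]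
        refine Finset.sum_congr rfl fun ω _ => ?_
        split_ifs
        · simp_rw [Finset.mul_sum]
        · simp
    _ = _ := by
        rw [Finset.mul_sum]
        refine Finset.sum_congr rfl fun ω _ => ?_
        split_ifs <;> ring

theorem triFirstStepSum_two_mul_le {x z l : ℝ} (hx : 0 < x) (hz : 0 < z) {v : Fin 6 → ℝ}
    (hl0 : 0 ≤ l) (hv : ∀ s, 0 ≤ v s)
    (hl : ∀ c, ∑ a, ∑ b, (if triThreeStepSAW a b c then
      triStepWeight x z a * triStepWeight x z b * v a else 0) = l * v c) (k : ℕ) :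
    triFirstStepSum (2 * k) x z v ≤ l ^ k * triFirstStepSum 0 x z v := by
  induction k with
  | zero => simp
  | succ k ih =>
    calc _ ≤ l * triFirstStepSum (2 * k) x z v := triFirstStepSum_add_two_le hx hz hv hl (2 * k)
      _ ≤ l * (l ^ k * triFirstStepSum 0 x z v) := by gcongr
      _ = _ := by ring

theorem mul_triSawCount_le {x z m : ℝ} (hx : 0 < x) (hz : 0 < z) {v : Fin 6 → ℝ}
    (hm : ∀ s, m ≤ v s) (n : ℕ) :
    m * triSawCount (n + 1) x z ≤ triFirstStepSum n x z v := by
  unfold triSawCount triFirstStepSum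
  rw [← Finset.sum_filter, Finset.mul_sum]
  refine Finset.sum_le_sum fun ω _ => ?_
  rw [mul_comm]
  exact mul_le_mul_of_nonneg_left (hm _) (triWeight_pos hx hz ω).le

theorem triSawCount_nonneg {x z : ℝ} (hx : 0 < x) (hz : 0 < z) (n : ℕ) :
    0 ≤ triSawCount n x z :=
  Finset.sum_nonneg fun ω _ => (triWeight_pos hx hz ω).le

/-- A geometric bound on the walks with an odd number of steps bounds the connective constant. -/
theorem triSawMu_le_sqrt {x z C l : ℝ} (hx : 0 < x) (hz : 0 < z) (hC : 0 < C) (hl : 0 < l)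
    (h : ∀ k : ℕ, triSawCount (2 * k + 1) x z ≤ C * l ^ k) :
    triSawMu x z ≤ √l := by
  have hs : 0 < √l := Real.sqrt_pos.2 hl
  have hbdd : BddBelow (Set.range fun n : ℕ => triSawCount (n + 1) x z ^ (1 / (n + 1 : ℝ))) := by
    refine ⟨0, ?_⟩
    rintro _ ⟨n, rfl⟩
    exact Real.rpow_nonneg (triSawCount_nonneg hx hz _) _
  have hle : ∀ k : ℕ, triSawMu x z ≤ (C / √l) ^ (1 / (2 * k + 1 : ℝ)) * √l := by
    intro k
    have hk : (0 : ℝ) ≤ 1 / (2 * k + 1) := by positivity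
    calc triSawMu x z ≤ triSawCount (2 * k + 1) x z ^ (1 / (2 * k + 1 : ℝ)) := by
          simpa [triSawMu] using ciInf_le hbdd (2 * k)
      _ ≤ (C / √l * √l ^ (2 * k + 1)) ^ (1 / (2 * k + 1 : ℝ)) := by
          refine Real.rpow_le_rpow (triSawCount_nonneg hx hz _) ((h k).trans_eq ?_) hk
          rw [pow_succ, pow_mul, Real.sq_sqrt hl.le]
          field_simp
      _ = _ := by
          rw [Real.mul_rpow (by positivity) (by positivity), ← Real.rpow_natCast,
            ← Real.rpow_mul hs.le]
          push_cast
          rw [mul_one_div_cancel (by positivity), Real.rpow_one]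
  have hexp : Filter.Tendsto (fun k : ℕ => 1 / (2 * k + 1 : ℝ)) Filter.atTop (nhds 0) := by
    have := (tendsto_one_div_add_atTop_nhds_zero_nat (𝕜 := ℝ)).comp
      (Filter.tendsto_id.const_mul_atTop' (two_pos : 0 < 2))
    simpa [Function.comp_def] using this
  have hlim := ((tendsto_const_nhds (x := C / √l)).rpow hexp (Or.inl (by positivity))).mul_const (√l)
  rw [Real.rpow_zero, one_mul] at hlim
  exact ge_of_tendsto' hlim hle

/-- The three-step matrix acts on vectors that are constant on each of the two step classes by a
two-by-two matrix. -/
theorem sum_triThreeStepSAW (x z p q : ℝ) (c : Fin 6) :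
    ∑ a, ∑ b, (if triThreeStepSAW a b c then
      triStepWeight x z a * triStepWeight x z b * triStepWeight p q a else 0) =
    triStepWeight ((9 * x ^ 2 + 7 * x * z) * p + (5 * x * z + 2 * z ^ 2) * q)
      ((10 * x ^ 2 + 4 * x * z) * p + (8 * x * z + z ^ 2) * q) c := by
  fin_cases c <;>
    simp [Fin.sum_univ_six, triThreeStepSAW, triStep, triStepWeight] <;> ring

theorem triSawMu_le_bound_m1_n3 (x z : ℝ) (hx : 0 < x) (hz : 0 < z) :
    triSawMu x z ≤ (2 : ℝ) ^ (-(1 / 2 : ℝ)) *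
      (9 * x ^ 2 + 15 * x * z + z ^ 2 +
        Real.sqrt (81 * x ^ 4 + 182 * x ^ 3 * z + 143 * x ^ 2 * z ^ 2 + 34 * x * z ^ 3 +
          z ^ 4)) ^ (1 / 2 : ℝ) := by
  set D := 81 * x ^ 4 + 182 * x ^ 3 * z + 143 * x ^ 2 * z ^ 2 + 34 * x * z ^ 3 + z ^ 4 with hD
  set l := (9 * x ^ 2 + 15 * x * z + z ^ 2 + √D) / 2 with hl
  have hD0 : 0 < D := by positivity
  have hl0 : 0 < l := by positivity
  have hsq : √D ^ 2 = D := Real.sq_sqrt hD0.le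
  set p := 5 * x * z + 2 * z ^ 2 with hp
  set q := l - (9 * x ^ 2 + 7 * x * z) with hq
  have hp0 : 0 < p := by positivity
  have hq0 : 0 < q := by
    have : 9 * x ^ 2 - x * z - z ^ 2 < √D := by
      apply Real.lt_sqrt_of_sq_lt
      have : 0 < 4 * (5 * x * z + 2 * z ^ 2) * (10 * x ^ 2 + 4 * x * z) := by positivity
      rw [hD]
      linarith
    rw [hq, hl]
    linarith
  have hv : ∀ s, min p q ≤ triStepWeight p q s := fun s => by
    unfold triStepWeight; split_ifs <;> simp
  have hm : 0 < min p q := lt_min hp0 hq0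
  have heig : ∀ c, ∑ a, ∑ b, (if triThreeStepSAW a b c then
      triStepWeight x z a * triStepWeight x z b * triStepWeight p q a else 0) =
      l * triStepWeight p q c := by
    intro c
    have h1 : (9 * x ^ 2 + 7 * x * z) * p + (5 * x * z + 2 * z ^ 2) * q = l * p := by
      rw [hq, ← hp]; ring
    have h2 : (10 * x ^ 2 + 4 * x * z) * p + (8 * x * z + z ^ 2) * q = l * q := by
      rw [hq, hp, hl]
      rw [hD] at hsq ⊢
      linear_combination (-1 / 4) * hsq
    rw [sum_triThreeStepSAW, h1, h2]
    unfold triStepWeight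
    split_ifs <;> rfl
  have hgeom : ∀ k : ℕ, triSawCount (2 * k + 1) x z ≤
      ((|triFirstStepSum 0 x z (triStepWeight p q)| + 1) / min p q) * l ^ k := by
    intro k
    rw [div_mul_eq_mul_div, le_div_iff₀ hm, mul_comm]
    calc _ ≤ _ := mul_triSawCount_le hx hz hv (2 * k)
      _ ≤ _ := triFirstStepSum_two_mul_le hx hz hl0.le (fun s => hm.le.trans (hv s)) heig k
      _ ≤ _ := by
        rw [mul_comm]
        gcongr
        exact (le_abs_self _).trans (by linarith)
  refine (triSawMu_le_sqrt hx hz (by positivity) hl0 hgeom).trans_eq ?_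
  rw [Real.sqrt_eq_rpow, hl, Real.div_rpow (by positivity) (by norm_num), Real.rpow_neg (by norm_num)]
  ring
end
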